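/- Let B=(1,b_2,...,b_k) with 1<b_2<...<b_k positive integers (k≥2), let c = max{O_B(r) : 0 ≤ r ≤ b_k−1}, and let a,h,d be positive integers with gcd(a,d)=1. If a ≥ (c−1)b_k, then for every r with 0 ≤ r ≤ a−1, N_{dr} = O_B(r)·h·a + r·d; that is, the minimum in the definition of N_{dr} over m∈ℕ of O_B(ma+r)·h·a + (ma+r)·d is attained at m = 0. -/

import Mathlib

/-- `OB k b M` is the minimum of `x 1 + ⋯ + x k` over all nonnegative integer
solutions of `x 1 * b 1 + ⋯ + x k * b k = M`. -/
noncomputable def OB (k : ℕ) (b : ℕ → ℕ) (M : ℕ) : ℕ :=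
  sInf {n : ℕ | ∃ x : ℕ → ℕ,
    (∑ i ∈ Finset.Icc 1 k, x i * b i) = M ∧ (∑ i ∈ Finset.Icc 1 k, x i) = n}

theorem OB_le_sum (k : ℕ) (b x : ℕ → ℕ) :
    OB k b (∑ i ∈ Finset.Icc 1 k, x i * b i) ≤ ∑ i ∈ Finset.Icc 1 k, x i :=
  Nat.sInf_le ⟨x, rfl, rfl⟩

theorem exists_sum_eq_OB {k : ℕ} {b : ℕ → ℕ} (hk : 1 ≤ k) (hb1 : b 1 = 1) (M : ℕ) :
    ∃ x : ℕ → ℕ, (∑ i ∈ Finset.Icc 1 k, x i * b i) = M ∧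
      (∑ i ∈ Finset.Icc 1 k, x i) = OB k b M := by
  refine Nat.sInf_mem (s := {n : ℕ | ∃ x : ℕ → ℕ,
    (∑ i ∈ Finset.Icc 1 k, x i * b i) = M ∧ (∑ i ∈ Finset.Icc 1 k, x i) = n}) ?_
  exact ⟨_, fun i => if i = 1 then M else 0, by simp [ite_mul, hk, hb1], rfl⟩

theorem OB_zero (k : ℕ) (b : ℕ → ℕ) : OB k b 0 = 0 := by
  simpa using OB_le_sum k b 0

/-- Using `q` further copies of the largest part costs at most `q`. -/
theorem OB_mul_add_le {k : ℕ} {b : ℕ → ℕ} (hk : 1 ≤ k) (hb1 : b 1 = 1) (q s : ℕ) :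
    OB k b (q * b k + s) ≤ q + OB k b s := by
  obtain ⟨x, hx, hx'⟩ := exists_sum_eq_OB hk hb1 s
  have := OB_le_sum k b fun i => (if i = k then q else 0) + x i
  simpa [add_mul, ite_mul, Finset.sum_add_distrib, hx, hx', hk] using this

theorem le_OB_mul {k : ℕ} {b : ℕ → ℕ} (hk : 1 ≤ k) (hb1 : b 1 = 1)
    (hmax : ∀ i ∈ Finset.Icc 1 k, b i ≤ b k) (M : ℕ) : M ≤ OB k b M * b k := by
  obtain ⟨x, hx, hx'⟩ := exists_sum_eq_OB hk hb1 M
  rw [← hx', Finset.sum_mul]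
  nth_rw 1 [← hx]
  exact Finset.sum_le_sum fun i hi => Nat.mul_le_mul_left _ (hmax i hi)

theorem le_last_of_lt_succ {k : ℕ} {b : ℕ → ℕ}
    (hmono : ∀ i, 1 ≤ i → i < k → b i < b (i + 1)) :
    ∀ i ∈ Finset.Icc 1 k, b i ≤ b k := by
  intro i hi
  obtain ⟨hi1, hik⟩ := Finset.mem_Icc.1 hi
  induction hik using Nat.decreasingInduction with
  | self => exact le_rfl
  | of_succ j hj ih =>
    exact (hmono j hi1 hj).le.trans (ih (Finset.mem_Icc.2 ⟨by omega, hj⟩) (by omega))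

/-- The optimal size at `r` is at most the one at any `M` exceeding `r` by `(c - 1) * b k`. -/
theorem OB_le_OB_of_add_le {k : ℕ} {b : ℕ → ℕ} (hk : 1 ≤ k) (hb1 : b 1 = 1)
    (hmax : ∀ i ∈ Finset.Icc 1 k, b i ≤ b k) {c : ℕ} (hc : ∀ s < b k, OB k b s ≤ c)
    {r M : ℕ} (hM : (c - 1) * b k + r ≤ M) : OB k b r ≤ OB k b M := by
  have hpos : 0 < b k := by
    have := hmax 1 (Finset.mem_Icc.2 ⟨le_rfl, hk⟩)
    omega
  have hMle := le_OB_mul hk hb1 hmax M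
  have hr := OB_mul_add_le hk hb1 (r / b k) (r % b k)
  have hdiv := Nat.div_add_mod' r (b k)
  rw [hdiv] at hr
  have hs := hc _ (Nat.mod_lt r hpos)
  refine hr.trans ?_
  rcases Nat.eq_zero_or_pos (r % b k) with h0 | h0
  · rw [h0, OB_zero, add_zero]
    exact Nat.le_of_mul_le_mul_right (by omega) hpos
  · have : (c - 1) + r / b k < OB k b M :=
      Nat.lt_of_mul_lt_mul_right (a := b k) (by rw [add_mul]; omega)
    omega

theorem stmt_2 (k : ℕ) (b : ℕ → ℕ) (hk : 2 ≤ k) (hb1 : b 1 = 1)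
    (hmono : ∀ i, 1 ≤ i → i < k → b i < b (i + 1))
    (c : ℕ) (hc : c = (Finset.range (b k)).sup fun r => OB k b r)
    (a h d : ℕ) (ha : 0 < a) (hh : 0 < h) (hd : 0 < d)
    (hgcd : Nat.gcd a d = 1) (ha' : (c - 1) * b k ≤ a)
    (r : ℕ) (hr : r ≤ a - 1) :
    sInf {n : ℕ | ∃ m : ℕ, n = OB k b (m * a + r) * h * a + (m * a + r) * d}
      = OB k b r * h * a + r * d := by
  refine IsLeast.csInf_eq ⟨⟨0, by simp⟩, ?_⟩
  rintro _ ⟨m, rfl⟩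
  rcases Nat.eq_zero_or_pos m with rfl | hm
  · simp
  have hO : OB k b r ≤ OB k b (m * a + r) := by
    refine OB_le_OB_of_add_le (c := c) (by omega) hb1 (le_last_of_lt_succ hmono) ?_ ?_
    · intro s hs
      rw [hc]
      exact Finset.le_sup (f := fun r => OB k b r) (Finset.mem_range.2 hs)
    · have := Nat.le_mul_of_pos_left a hm
      omega
  gcongr
  omega
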